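/- Let Ω be a differential 2-form of rank 4 on a smooth 4-dimensional manifold M. Then there exists a unique 1-form φ_Ω such that φ_Ω ∧ Ω = ω_Ω ∧ dω_Ω, and the assignment Ω ↦ φ_Ω is functorial: φ*(φ_Ω) = φ_{φ*Ω} for every diffeomorphism φ of M. Moreover, if the germ of Ω at a point is of type 1 or of type 2, then φ_Ω = 0 near that point. -/

import Mathlib

/-!  Coordinate formalization of differential forms in four variables,
     following "The equivalence problem of differential 2-forms in 4 variables". -/

open Real Filter

/-- Points of `ℝ⁴`; the coordinates `x¹, x², x³, x⁴` of the paper are `x 0, x 1, x 2, x 3`. -/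
abbrev Pt := Fin 4 → ℝ

/-- Partial derivative `∂f/∂xⁱ`. -/
noncomputable def pd (i : Fin 4) (f : Pt → ℝ) (x : Pt) : ℝ :=
  fderiv ℝ f x (Pi.single i 1)

/-- Second partial derivative `∂²f/∂xⁱ∂xʲ`. -/
noncomputable def pd2 (i j : Fin 4) (f : Pt → ℝ) (x : Pt) : ℝ :=
  pd i (fun y => pd j f y) x

/-- Differential forms of degree 0,1,2,3,4 on `ℝ⁴`, given by their (skew-symmetric)
    coordinate components, and vector fields. -/
abbrev Form0 := Pt → ℝ
abbrev Form1 := Pt → Fin 4 → ℝ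
abbrev Form2 := Pt → Fin 4 → Fin 4 → ℝ
abbrev Form3 := Pt → Fin 4 → Fin 4 → Fin 4 → ℝ
abbrev Form4 := Pt → Fin 4 → Fin 4 → Fin 4 → Fin 4 → ℝ
abbrev Vec := Pt → Fin 4 → ℝ

/-- A 2-form has skew-symmetric components. -/
def Alt2 (B : Form2) : Prop := ∀ x i j, B x i j = - B x j i

/-- Exterior derivative of a function. -/
noncomputable def d0 (f : Form0) : Form1 := fun x i => pd i f x

/-- Exterior derivative of a 1-form. -/
noncomputable def d1 (ω : Form1) : Form2 := fun x i j =>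
  pd i (fun y => ω y j) x - pd j (fun y => ω y i) x

/-- Exterior derivative of a 2-form. -/
noncomputable def d2 (B : Form2) : Form3 := fun x i j k =>
  pd i (fun y => B y j k) x - pd j (fun y => B y i k) x + pd k (fun y => B y i j) x

/-- Wedge product of two 1-forms. -/
def w11 (ω η : Form1) : Form2 := fun x i j => ω x i * η x j - ω x j * η x i

/-- Wedge product of a 1-form and a 2-form. -/
def w12 (ω : Form1) (B : Form2) : Form3 := fun x i j k =>
  ω x i * B x j k - ω x j * B x i k + ω x k * B x i j

/-- Wedge product of a 1-form and a 3-form. -/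
def w13 (ω : Form1) (C : Form3) : Form4 := fun x i j k l =>
  ω x i * C x j k l - ω x j * C x i k l + ω x k * C x i j l - ω x l * C x i j k

/-- Wedge product of two 2-forms. -/
def w22 (A B : Form2) : Form4 := fun x i j k l =>
  A x i j * B x k l - A x i k * B x j l + A x i l * B x j k
    + A x j k * B x i l - A x j l * B x i k + A x k l * B x i j

/-- A 2-form is of rank 4 when `Ω ∧ Ω` vanishes nowhere. -/
def Rank4 (B : Form2) : Prop := ∀ x, w22 B B x ≠ 0

/-- Interior products `i_X`. -/
def i1 (X : Vec) (ω : Form1) : Form0 := fun x => ∑ i, X x i * ω x i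
def i2 (X : Vec) (B : Form2) : Form1 := fun x j => ∑ i, X x i * B x i j
def i3 (X : Vec) (C : Form3) : Form2 := fun x j k => ∑ i, X x i * C x i j k
def i4 (X : Vec) (D : Form4) : Form3 := fun x j k l => ∑ i, X x i * D x i j k l

/-- Evaluation `B(X,Y)` of a 2-form on two vector fields. -/
def ev2 (B : Form2) (X Y : Vec) : Form0 := fun x => ∑ i, ∑ j, X x i * Y x j * B x i j

/-- Evaluation `D(X,Y,Z,W)` of a 4-form on four vector fields. -/
def ev4 (D : Form4) (X Y Z W : Vec) : Form0 := fun x =>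
  ∑ i, ∑ j, ∑ k, ∑ l, X x i * Y x j * Z x k * W x l * D x i j k l

/-- Lie derivative of a 1-form (Cartan's magic formula). -/
noncomputable def lie1 (X : Vec) (ω : Form1) : Form1 := fun x i =>
  d0 (i1 X ω) x i + i2 X (d1 ω) x i

/-- Lie derivative of a 2-form (Cartan's magic formula). -/
noncomputable def lie2 (X : Vec) (B : Form2) : Form2 := fun x i j =>
  d1 (i2 X B) x i j + i3 X (d2 B) x i j

/-- Lie bracket of two vector fields. -/
noncomputable def bracket (X Y : Vec) : Vec := fun x i =>
  ∑ j, (X x j * pd j (fun y => Y y i) x - Y x j * pd j (fun y => X y i) x)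

/-- Derivative `X(f)` of a function along a vector field. -/
noncomputable def dirDeriv (X : Vec) (f : Form0) : Form0 := fun x => ∑ j, X x j * pd j f x

/-- Pullback of a 1-form under a smooth map. -/
noncomputable def pull1 (φ : Pt → Pt) (ω : Form1) : Form1 := fun x i =>
  ∑ a, ω (φ x) a * pd i (fun y => φ y a) x

/-- Pullback of a 2-form under a smooth map. -/
noncomputable def pull2 (φ : Pt → Pt) (B : Form2) : Form2 := fun x i j =>
  ∑ a, ∑ b, B (φ x) a b * pd i (fun y => φ y a) x * pd j (fun y => φ y b) x

/-- A pair of mutually inverse smooth maps: a diffeomorphism of `ℝ⁴` (with inverse). -/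
def IsDiffeo (φ ψ : Pt → Pt) : Prop :=
  ContDiff ℝ (⊤ : ℕ∞) φ ∧ ContDiff ℝ (⊤ : ℕ∞) ψ ∧ (∀ x, ψ (φ x) = x) ∧ (∀ x, φ (ψ x) = x)

/-- The covector with components `c` as a linear functional on the tangent space `ℝ⁴`. -/
noncomputable def covec (c : Fin 4 → ℝ) : Pt →ₗ[ℝ] ℝ :=
  ∑ i, c i • (LinearMap.proj i : Pt →ₗ[ℝ] ℝ)

/-- The class of a 1-form `ω` at `x`: the codimension of the space of tangent vectors `v`
    with `i_v ω = 0` and `i_v (dω) = 0`. -/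
noncomputable def classAt (ω : Form1) (x : Pt) : ℕ :=
  4 - Module.finrank ℝ
    ↥(LinearMap.ker (covec (ω x)) ⊓ ⨅ j, LinearMap.ker (covec (fun i => d1 ω x i j)))

/-- Components of the constant 2-form `dxᵃ ∧ dxᵇ`. -/
def dxw (a b : Fin 4) : Fin 4 → Fin 4 → ℝ := fun i j =>
  (if i = a ∧ j = b then (1:ℝ) else 0) - (if i = b ∧ j = a then (1:ℝ) else 0)

/-- A germ of 2-form (with associated 1-form `ω = ω_Ω`) is of type `t` at `x₀`:
    `ω` is nonsingular at `x₀` and of constant class `t` near `x₀`. -/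
def IsTypeAt (ω : Form1) (t : ℕ) (x₀ : Pt) : Prop :=
  ω x₀ ≠ 0 ∧ ∀ᶠ x in nhds x₀, classAt ω x = t

/-! ### Pointwise linear algebra -/

/-- Pointwise wedge of a covector and a 2-covector. -/
def W12 (t : Fin 4 → ℝ) (b : Fin 4 → Fin 4 → ℝ) : Fin 4 → Fin 4 → Fin 4 → ℝ := fun i j k =>
  t i * b j k - t j * b i k + t k * b i j

/-- Pfaffian. -/
def Pf (b : Fin 4 → Fin 4 → ℝ) : ℝ := b 0 1 * b 2 3 - b 0 2 * b 1 3 + b 0 3 * b 1 2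

/-- Numerator of the solution of `t ∧ b = c`. -/
def sol (b : Fin 4 → Fin 4 → ℝ) (c : Fin 4 → Fin 4 → Fin 4 → ℝ) (i : Fin 4) : ℝ :=
  b i 3 * c 0 1 2 - b i 2 * c 0 1 3 + b i 1 * c 0 2 3 - b i 0 * c 1 2 3

lemma alt_diag {b : Fin 4 → Fin 4 → ℝ} (h : ∀ i j, b i j = - b j i) (i : Fin 4) : b i i = 0 := by
  have := h i i
  linarith

lemma sol_W12 {b : Fin 4 → Fin 4 → ℝ} (h : ∀ i j, b i j = - b j i) (t : Fin 4 → ℝ) (i : Fin 4) :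
    sol b (W12 t b) i = Pf b * t i := by
  have d := alt_diag h
  have h10 := h 1 0
  have h20 := h 2 0
  have h30 := h 3 0
  have h21 := h 2 1
  have h31 := h 3 1
  have h32 := h 3 2
  fin_cases i <;> simp [sol, W12, Pf, d, h10, h20, h30, h21, h31, h32] <;> ring

lemma W12_inj {b : Fin 4 → Fin 4 → ℝ} (h : ∀ i j, b i j = - b j i) (hp : Pf b ≠ 0)
    {t t' : Fin 4 → ℝ} (e : W12 t b = W12 t' b) : t = t' := by
  funext i
  have h1 := sol_W12 h t i
  rw [e, sol_W12 h t' i] at h1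
  exact (mul_left_cancel₀ hp h1).symm

lemma W12_sol {b a : Fin 4 → Fin 4 → ℝ} (h : ∀ i j, b i j = - b j i) (hp : Pf b ≠ 0)
    (ha : ∀ i j, a i j = - a j i) (s : Fin 4 → ℝ) :
    W12 (fun i => sol b (W12 s a) i / Pf b) b = W12 s a := by
  have d := alt_diag h
  have h10 := h 1 0
  have h20 := h 2 0
  have h30 := h 3 0
  have h21 := h 2 1
  have h31 := h 3 1
  have h32 := h 3 2
  have da := alt_diag ha
  have a10 := ha 1 0
  have a20 := ha 2 0
  have a30 := ha 3 0
  have a21 := ha 2 1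
  have a31 := ha 3 1
  have a32 := ha 3 2
  have key : ∀ i j k, W12 (sol b (W12 s a)) b i j k = Pf b * W12 s a i j k := by
    intro i j k
    fin_cases i <;> fin_cases j <;> fin_cases k <;>
      simp [sol, W12, Pf, d, h10, h20, h30, h21, h31, h32, da, a10, a20, a30, a21, a31, a32] <;> ring
  funext i j k
  have := key i j k
  rw [eq_comm, ← mul_right_inj' hp, ← this]
  simp only [W12]
  field_simp

lemma Pf_ne {b : Fin 4 → Fin 4 → ℝ} (h : ∀ i j, b i j = - b j i)
    (hw : w22 (fun _ => b) (fun _ => b) 0 ≠ 0) : Pf b ≠ 0 := by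
  intro hp
  apply hw
  have d := alt_diag h
  have h10 := h 1 0
  have h20 := h 2 0
  have h30 := h 3 0
  have h21 := h 2 1
  have h31 := h 3 1
  have h32 := h 3 2
  unfold Pf at hp
  funext i j k l
  fin_cases i <;> fin_cases j <;> fin_cases k <;> fin_cases l <;>
    simp [w22, d, h10, h20, h30, h21, h31, h32] <;> first | done | linarith

/-- The pull back of a 2-covector by a matrix. -/
def P2 (J : Fin 4 → Fin 4 → ℝ) (b : Fin 4 → Fin 4 → ℝ) : Fin 4 → Fin 4 → ℝ := fun i j =>
  ∑ p, ∑ q, b p q * J p i * J q j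

def P1 (J : Fin 4 → Fin 4 → ℝ) (t : Fin 4 → ℝ) : Fin 4 → ℝ := fun i => ∑ p, t p * J p i

def P3 (J : Fin 4 → Fin 4 → ℝ) (c : Fin 4 → Fin 4 → Fin 4 → ℝ) :
    Fin 4 → Fin 4 → Fin 4 → ℝ := fun i j k =>
  ∑ p, ∑ q, ∑ r, c p q r * J p i * J q j * J r k

lemma P2_alt {b : Fin 4 → Fin 4 → ℝ} (h : ∀ i j, b i j = - b j i) (J : Fin 4 → Fin 4 → ℝ)
    (i j : Fin 4) : P2 J b i j = - P2 J b j i := by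
  unfold P2
  rw [Finset.sum_comm, ← Finset.sum_neg_distrib]
  refine Finset.sum_congr rfl fun p _ => ?_
  rw [← Finset.sum_neg_distrib]
  refine Finset.sum_congr rfl fun q _ => ?_
  rw [h q p]; ring

lemma P3_W12 (J : Fin 4 → Fin 4 → ℝ) (t : Fin 4 → ℝ) (b : Fin 4 → Fin 4 → ℝ) :
    W12 (P1 J t) (P2 J b) = P3 J (W12 t b) := by
  funext i j k
  simp only [W12, P1, P2, P3, Fin.sum_univ_four]
  ring

lemma Pf_sq {b : Fin 4 → Fin 4 → ℝ} (h : ∀ i j, b i j = - b j i) :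
    (Matrix.of b).det = Pf b ^ 2 := by
  have d := alt_diag h
  have h10 := h 1 0
  have h20 := h 2 0
  have h30 := h 3 0
  have h21 := h 2 1
  have h31 := h 3 1
  have h32 := h 3 2
  rw [Matrix.det_succ_row_zero]
  simp [Fin.sum_univ_four, Matrix.det_fin_three, Fin.succAbove, Pf, d, h10, h20, h30, h21, h31, h32]
  ring

lemma Pf_P2_ne {b : Fin 4 → Fin 4 → ℝ} (h : ∀ i j, b i j = - b j i) (hp : Pf b ≠ 0)
    {J K : Fin 4 → Fin 4 → ℝ} (hJ : Matrix.of K * Matrix.of J = 1) : Pf (P2 J b) ≠ 0 := by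
  have e : Matrix.of (P2 J b) = (Matrix.of J).transpose * Matrix.of b * Matrix.of J := by
    ext i j
    simp only [P2, Matrix.mul_apply, Matrix.of_apply, Matrix.transpose_apply, Fin.sum_univ_four]
    ring
  have hd : (Matrix.of J).det ≠ 0 := by
    intro h0
    have := congrArg Matrix.det hJ
    simp [Matrix.det_mul, h0] at this
  have h2 := Pf_sq (P2_alt h J)
  rw [e, Matrix.det_mul, Matrix.det_mul, Matrix.det_transpose, Pf_sq h] at h2
  intro h0
  rw [h0] at h2
  have : (Matrix.of J).det * Pf b ^ 2 * (Matrix.of J).det ≠ 0 :=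
    mul_ne_zero (mul_ne_zero hd (pow_ne_zero _ hp)) hd
  exact this (by rw [h2]; ring)

lemma W12_zero_of_ker {a : Fin 4 → Fin 4 → ℝ} (ha : ∀ i j, a i j = - a j i) (s : Fin 4 → ℝ)
    (hK : 2 ≤ Module.finrank ℝ
      ↥(LinearMap.ker (covec s) ⊓ ⨅ j, LinearMap.ker (covec (fun i => a i j)))) :
    W12 s a = 0 := by
  have da := alt_diag ha
  have a10 := ha 1 0
  have a20 := ha 2 0
  have a30 := ha 3 0
  have a21 := ha 2 1
  have a31 := ha 3 1
  have a32 := ha 3 2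
  set c : Fin 4 → ℝ := ![W12 s a 1 2 3, - W12 s a 0 2 3, W12 s a 0 1 3, - W12 s a 0 1 2] with hc
  by_cases h0 : c = 0
  · have c0 := congrFun h0 0
    have c1 := congrFun h0 1
    have c2 := congrFun h0 2
    have c3 := congrFun h0 3
    simp [hc, W12] at c0 c1 c2 c3
    funext i j k
    fin_cases i <;> fin_cases j <;> fin_cases k <;>
      simp [W12, da, a10, a20, a30, a21, a31, a32] <;> first | done | linarith
  · exfalso
    obtain ⟨m, hm⟩ := Function.ne_iff.mp h0
    have hle : (LinearMap.ker (covec s) ⊓ ⨅ j, LinearMap.ker (covec (fun i => a i j)))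
        ≤ Submodule.span ℝ {c} := by
      intro v hv
      rw [Submodule.mem_inf, Submodule.mem_iInf] at hv
      obtain ⟨h1, h2⟩ := hv
      have e1 : v 0 * s 0 + v 1 * s 1 + v 2 * s 2 + v 3 * s 3 = 0 := by
        have := LinearMap.mem_ker.mp h1
        simp [covec, Fin.sum_univ_four] at this
        linarith
      have e2 : ∀ j, v 0 * a 0 j + v 1 * a 1 j + v 2 * a 2 j + v 3 * a 3 j = 0 := by
        intro j
        have := LinearMap.mem_ker.mp (h2 j)
        simp [covec, Fin.sum_univ_four] at this
        linarith
      have e3 : ∀ j k, v 0 * W12 s a 0 j k + v 1 * W12 s a 1 j k + v 2 * W12 s a 2 j k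
          + v 3 * W12 s a 3 j k = 0 := by
        intro j k
        simp only [W12]
        linear_combination a j k * e1 - s j * e2 k + s k * e2 j
      have e01 := e3 0 1
      have e02 := e3 0 2
      have e03 := e3 0 3
      have e12 := e3 1 2
      have e13 := e3 1 3
      have e23 := e3 2 3
      simp only [W12, da, a10, a20, a30, a21, a31, a32] at e01 e02 e03 e12 e13 e23
      have key : ∀ p q, v p * c q = v q * c p := by
        intro p q
        fin_cases p <;> fin_cases q <;> simp [hc, W12] <;> linarith
      rw [Submodule.mem_span_singleton]
      refine ⟨v m / c m, ?_⟩
      funext p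
      have hm' : c m ≠ 0 := hm
      have := key p m
      simp only [Pi.smul_apply, smul_eq_mul]
      field_simp
      linarith
    have := (Submodule.finrank_mono hle).trans (finrank_span_le_card (R := ℝ) ({c} : Set Pt))
    simp at this
    omega

/-! ### Calculus -/

lemma fderiv_eq_sum (f : Pt → ℝ) (x v : Pt) : fderiv ℝ f x v = ∑ c, pd c f x * v c := by
  conv_lhs => rw [pi_eq_sum_univ' v]
  rw [map_sum]
  refine Finset.sum_congr rfl fun c _ => ?_
  rw [map_smul, pd, smul_eq_mul, mul_comm]

lemma pd_comp {f : Pt → ℝ} {φ : Pt → Pt} {x : Pt} (hf : DifferentiableAt ℝ f (φ x))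
    (hφ : DifferentiableAt ℝ φ x) (i : Fin 4) :
    pd i (fun y => f (φ y)) x = ∑ c, pd c f (φ x) * pd i (fun y => φ y c) x := by
  have h : fderiv ℝ (fun y => f (φ y)) x = (fderiv ℝ f (φ x)).comp (fderiv ℝ φ x) :=
    fderiv_comp x hf hφ
  rw [pd, h, ContinuousLinearMap.comp_apply, fderiv_eq_sum]
  refine Finset.sum_congr rfl fun c _ => ?_
  congr 1
  rw [pd, fderiv_apply hφ c]
  rfl

lemma pd_mul {f g : Pt → ℝ} {x : Pt} (hf : DifferentiableAt ℝ f x) (hg : DifferentiableAt ℝ g x)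
    (i : Fin 4) : pd i (fun y => f y * g y) x = pd i f x * g x + f x * pd i g x := by
  unfold pd
  rw [fderiv_fun_mul hf hg]
  simp
  ring

lemma pd_sum {f : Fin 4 → Pt → ℝ} {x : Pt} (hf : ∀ p, DifferentiableAt ℝ (f p) x)
    (i : Fin 4) : pd i (fun y => ∑ p, f p y) x = ∑ p, pd i (f p) x := by
  unfold pd
  rw [fderiv_fun_sum fun p _ => hf p]
  simp

lemma pd_contDiff {f : Pt → ℝ} (hf : ContDiff ℝ (⊤ : ℕ∞) f) (i : Fin 4) :
    ContDiff ℝ (⊤ : ℕ∞) (pd i f) := by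
  unfold pd
  exact (hf.fderiv_right (m := (⊤ : ℕ∞)) (by simp)).clm_apply contDiff_const

lemma pd_symm {f : Pt → ℝ} (hf : ContDiff ℝ (⊤ : ℕ∞) f) (i j : Fin 4) (x : Pt) :
    pd i (pd j f) x = pd j (pd i f) x := by
  have hd : DifferentiableAt ℝ (fderiv ℝ f) x :=
    (hf.fderiv_right (m := (⊤ : ℕ∞)) (by simp)).differentiable (by simp) x
  have key : ∀ i j, pd i (pd j f) x = fderiv ℝ (fderiv ℝ f) x (Pi.single i 1) (Pi.single j 1) := by
    intro i j
    have : pd j f = fun y => fderiv ℝ f y (Pi.single j 1) := rfl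
    rw [this, pd, fderiv_clm_apply hd (differentiableAt_const _)]
    simp
  have hs : IsSymmSndFDerivAt ℝ f x := hf.contDiffAt.isSymmSndFDerivAt (by
    simp only [minSmoothness_of_isRCLikeNormedField]
    exact WithTop.coe_le_coe.mpr (le_top : (2 : ℕ∞) ≤ ⊤))
  rw [key, key]
  exact hs _ _

/-- Jacobian matrix. -/
noncomputable def Jac (φ : Pt → Pt) (x : Pt) : Fin 4 → Fin 4 → ℝ := fun a i =>
  pd i (fun y => φ y a) x

lemma Jac_inv {φ ψ : Pt → Pt} (h : IsDiffeo φ ψ) (x : Pt) :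
    Matrix.of (Jac ψ (φ x)) * Matrix.of (Jac φ x) = 1 := by
  obtain ⟨h1, h2, h3, -⟩ := h
  have hφ : DifferentiableAt ℝ φ x := h1.differentiable (by simp) x
  have hψ : DifferentiableAt ℝ ψ (φ x) := h2.differentiable (by simp) _
  ext a i
  rw [Matrix.mul_apply]
  have := pd_comp (f := fun z => ψ z a) (φ := φ) (x := x) (differentiableAt_pi.mp hψ a) hφ i
  simp only [Matrix.of_apply, Jac]
  rw [← this]
  simp only [h3]
  rw [pd, fderiv_apply differentiableAt_id a]
  simp [Matrix.one_apply, Pi.single_apply]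

lemma d2_pull {φ : Pt → Pt} (hφ : ContDiff ℝ (⊤ : ℕ∞) φ) {B : Form2}
    (hB : ContDiff ℝ (⊤ : ℕ∞) B) (hBa : Alt2 B) (x : Pt) :
    d2 (pull2 φ B) x = P3 (Jac φ x) (d2 B (φ x)) := by
  have hφc : ∀ a, ContDiff ℝ (⊤ : ℕ∞) (fun y => φ y a) := fun a => contDiff_pi.mp hφ a
  have hJ : ∀ a i, DifferentiableAt ℝ (fun y => pd i (fun y => φ y a) y) x := fun a i =>
    (pd_contDiff (hφc a) i).differentiable (by simp) x
  have hBc : ∀ a b, ContDiff ℝ (⊤ : ℕ∞) (fun y => B y a b) := fun a b =>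
    contDiff_pi.mp (contDiff_pi.mp hB a) b
  have hBd : ∀ a b, DifferentiableAt ℝ (fun y => B (φ y) a b) x := fun a b =>
    ((hBc a b).comp hφ).differentiable (by simp) x
  have hφd : DifferentiableAt ℝ φ x := hφ.differentiable (by simp) x
  have key : ∀ i j k, pd i (fun y => pull2 φ B y j k) x =
      ∑ a, ∑ b, ((∑ c, pd c (fun z => B z a b) (φ x) * Jac φ x c i) * Jac φ x a j * Jac φ x b k
        + B (φ x) a b * pd i (pd j (fun y => φ y a)) x * Jac φ x b k
        + B (φ x) a b * Jac φ x a j * pd i (pd k (fun y => φ y b)) x) := by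
    intro i j k
    unfold pull2
    rw [pd_sum fun a => DifferentiableAt.fun_sum fun b _ => ((hBd a b).fun_mul (hJ a j)).fun_mul (hJ b k)]
    refine Finset.sum_congr rfl fun a _ => ?_
    rw [pd_sum fun b => ((hBd a b).fun_mul (hJ a j)).fun_mul (hJ b k)]
    refine Finset.sum_congr rfl fun b _ => ?_
    rw [pd_mul ((hBd a b).fun_mul (hJ a j)) (hJ b k), pd_mul (hBd a b) (hJ a j),
      pd_comp (f := fun z => B z a b) ((hBc a b).differentiable (by simp) _) hφd]
    simp only [Jac]
    ring
  have hH : ∀ a i j, pd i (pd j (fun y => φ y a)) x = pd j (pd i (fun y => φ y a)) x :=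
    fun a i j => pd_symm (hφc a) i j x
  funext i j k
  have e1 : d2 (pull2 φ B) x i j k = pd i (fun y => pull2 φ B y j k) x
    - pd j (fun y => pull2 φ B y i k) x + pd k (fun y => pull2 φ B y i j) x := rfl
  rw [e1, key, key, key]
  have e2 : ∀ a b c, d2 B (φ x) a b c = pd a (fun z => B z b c) (φ x)
    - pd b (fun z => B z a c) (φ x) + pd c (fun z => B z a b) (φ x) := fun _ _ _ => rfl
  simp only [hH _ j i, hH _ k i, hH _ k j, P3, e2]
  have hb := hBa (φ x)
  have d := alt_diag hb
  have h10 := hb 1 0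
  have h20 := hb 2 0
  have h30 := hb 3 0
  have h21 := hb 2 1
  have h31 := hb 3 1
  have h32 := hb 3 2
  generalize Jac φ x = J
  simp only [Fin.sum_univ_four, d, h10, h20, h30, h21, h31, h32]
  ring

lemma d1_pull {φ : Pt → Pt} (hφ : ContDiff ℝ (⊤ : ℕ∞) φ) {ω : Form1}
    (hω : ContDiff ℝ (⊤ : ℕ∞) ω) (x : Pt) :
    d1 (pull1 φ ω) x = P2 (Jac φ x) (d1 ω (φ x)) := by
  have hφc : ∀ a, ContDiff ℝ (⊤ : ℕ∞) (fun y => φ y a) := fun a => contDiff_pi.mp hφ a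
  have hJ : ∀ a i, DifferentiableAt ℝ (fun y => pd i (fun y => φ y a) y) x := fun a i =>
    (pd_contDiff (hφc a) i).differentiable (by simp) x
  have hBc : ∀ a, ContDiff ℝ (⊤ : ℕ∞) (fun y => ω y a) := fun a => contDiff_pi.mp hω a
  have hBd : ∀ a, DifferentiableAt ℝ (fun y => ω (φ y) a) x := fun a =>
    ((hBc a).comp hφ).differentiable (by simp) x
  have hφd : DifferentiableAt ℝ φ x := hφ.differentiable (by simp) x
  have key : ∀ i j, pd i (fun y => pull1 φ ω y j) x =
      ∑ a, ((∑ c, pd c (fun z => ω z a) (φ x) * Jac φ x c i) * Jac φ x a j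
        + ω (φ x) a * pd i (pd j (fun y => φ y a)) x) := by
    intro i j
    unfold pull1
    rw [pd_sum fun a => (hBd a).fun_mul (hJ a j)]
    refine Finset.sum_congr rfl fun a _ => ?_
    rw [pd_mul (hBd a) (hJ a j),
      pd_comp (f := fun z => ω z a) ((hBc a).differentiable (by simp) _) hφd]
    simp only [Jac]
  have hH : ∀ a i j, pd i (pd j (fun y => φ y a)) x = pd j (pd i (fun y => φ y a)) x :=
    fun a i j => pd_symm (hφc a) i j x
  funext i j
  have e1 : d1 (pull1 φ ω) x i j = pd i (fun y => pull1 φ ω y j) x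
    - pd j (fun y => pull1 φ ω y i) x := rfl
  rw [e1, key, key]
  have e2 : ∀ a b, d1 ω (φ x) a b = pd a (fun z => ω z b) (φ x)
    - pd b (fun z => ω z a) (φ x) := fun _ _ => rfl
  simp only [hH _ j i, P2, e2]
  generalize Jac φ x = J
  simp only [Fin.sum_univ_four]
  ring

lemma d1_alt (ω : Form1) (x : Pt) (i j : Fin 4) : d1 ω x i j = - d1 ω x j i := by
  simp only [d1]; ring

/-- For a rank-4 smooth 2-form `Ω` with associated 1-form `ω = ω_Ω`:
there is a unique 1-form `φ_Ω` with `φ_Ω ∧ Ω = ω_Ω ∧ dω_Ω`; the assignment is functorial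
under diffeomorphisms; and if the germ of `Ω` at a point is of type 1 or 2 then `φ_Ω`
vanishes near that point. -/
theorem varphi_exists_functorial (Ω : Form2) (hΩs : ContDiff ℝ (⊤ : ℕ∞) Ω)
    (hΩa : Alt2 Ω) (hΩr : Rank4 Ω)
    (ω : Form1) (hωs : ContDiff ℝ (⊤ : ℕ∞) ω)
    (hω : ∀ x, w12 ω Ω x = d2 Ω x) :
    -- existence and uniqueness of `φ_Ω`
    (∃! θ : Form1, ContDiff ℝ (⊤ : ℕ∞) θ ∧ ∀ x, w12 θ Ω x = w12 ω (d1 ω) x) ∧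
    -- functoriality: `φ*(φ_Ω) = φ_{φ*Ω}` for every diffeomorphism `φ`
    (∀ φ ψ : Pt → Pt, IsDiffeo φ ψ →
      ∀ ω' θ θ' : Form1,
        (∀ x, w12 ω' (pull2 φ Ω) x = d2 (pull2 φ Ω) x) →
        (∀ x, w12 θ Ω x = w12 ω (d1 ω) x) →
        (∀ x, w12 θ' (pull2 φ Ω) x = w12 ω' (d1 ω') x) →
        θ' = pull1 φ θ) ∧
    -- if the germ of `Ω` at `x₀` is of type 1 or type 2, then `φ_Ω = 0` near `x₀`
    (∀ (x₀ : Pt) (t : ℕ), (t = 1 ∨ t = 2) → IsTypeAt ω t x₀ →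
      ∀ θ : Form1, (∀ x, w12 θ Ω x = w12 ω (d1 ω) x) →
        ∀ᶠ x in nhds x₀, θ x = 0) := by
  have hP : ∀ x, Pf (Ω x) ≠ 0 := fun x => Pf_ne (hΩa x) (hΩr x)
  refine ⟨?_, ?_, ?_⟩
  · refine ⟨fun x i => sol (Ω x) (W12 (ω x) (d1 ω x)) i / Pf (Ω x), ⟨?_, ?_⟩, ?_⟩
    · have hΩc : ∀ a b, ContDiff ℝ (⊤ : ℕ∞) (fun y => Ω y a b) := fun a b =>
        contDiff_pi.mp (contDiff_pi.mp hΩs a) b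
      have hωc : ∀ a, ContDiff ℝ (⊤ : ℕ∞) (fun y => ω y a) := fun a => contDiff_pi.mp hωs a
      have hdc : ∀ a b, ContDiff ℝ (⊤ : ℕ∞) (fun y => d1 ω y a b) := fun a b =>
        (pd_contDiff (hωc b) a).sub (pd_contDiff (hωc a) b)
      have hWc : ∀ a b c, ContDiff ℝ (⊤ : ℕ∞) (fun y => W12 (ω y) (d1 ω y) a b c) :=
        fun a b c => (((hωc a).mul (hdc b c)).sub ((hωc b).mul (hdc a c))).add
          ((hωc c).mul (hdc a b))
      have hPc : ContDiff ℝ (⊤ : ℕ∞) (fun y => Pf (Ω y)) :=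
        (((hΩc _ _).mul (hΩc _ _)).sub ((hΩc _ _).mul (hΩc _ _))).add ((hΩc _ _).mul (hΩc _ _))
      refine contDiff_pi.mpr fun i => ContDiff.div ?_ hPc hP
      exact ((((hΩc _ _).mul (hWc _ _ _)).sub ((hΩc _ _).mul (hWc _ _ _))).add
        ((hΩc _ _).mul (hWc _ _ _))).sub ((hΩc _ _).mul (hWc _ _ _))
    · intro x
      exact W12_sol (hΩa x) (hP x) (d1_alt ω x) (ω x)
    · rintro θ ⟨-, hθ⟩
      funext x
      refine W12_inj (hΩa x) (hP x) ?_
      rw [W12_sol (hΩa x) (hP x) (d1_alt ω x) (ω x)]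
      exact hθ x
  · intro φ ψ hd ω' θ θ' h1 h2 h3
    have hpull : ∀ x, pull2 φ Ω x = P2 (Jac φ x) (Ω (φ x)) := fun x => rfl
    have halt : ∀ x, ∀ i j, pull2 φ Ω x i j = - pull2 φ Ω x j i := fun x =>
      P2_alt (hΩa (φ x)) (Jac φ x)
    have hne : ∀ x, Pf (pull2 φ Ω x) ≠ 0 := fun x =>
      Pf_P2_ne (hΩa (φ x)) (hP (φ x)) (Jac_inv hd x)
    have hω' : ω' = pull1 φ ω := by
      funext x
      refine W12_inj (halt x) (hne x) ?_
      refine (h1 x).trans ?_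
      rw [d2_pull hd.1 hΩs hΩa, ← hω (φ x)]
      exact (P3_W12 _ _ _).symm
    subst hω'
    funext x
    refine W12_inj (halt x) (hne x) ?_
    refine (h3 x).trans ?_
    have e1 : w12 (pull1 φ ω) (d1 (pull1 φ ω)) x
        = W12 (P1 (Jac φ x) (ω (φ x))) (d1 (pull1 φ ω) x) := rfl
    have e2 : W12 (pull1 φ θ x) (pull2 φ Ω x) = P3 (Jac φ x) (w12 θ Ω (φ x)) :=
      P3_W12 (Jac φ x) (θ (φ x)) (Ω (φ x))
    rw [e1, e2, d1_pull hd.1 hωs, P3_W12, h2]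
    rfl
  · intro x₀ t ht hT θ hθ
    filter_upwards [hT.2] with x hx
    refine W12_inj (hΩa x) (hP x) ?_
    refine (hθ x).trans ?_
    have h0 : W12 (ω x) (d1 ω x) = 0 := by
      refine W12_zero_of_ker (d1_alt ω x) (ω x) ?_
      unfold classAt at hx
      omega
    refine Eq.trans h0 ?_
    funext i j k
    simp [W12]
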